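/- arXiv:1906.03234 — 5 statements merged into one kernel-verified Lean document; each statement's English description precedes it below -/
import Mathlib

section
/- For a manifold $M$ on which the de Rham theorem holds, the sequence $0 \to H^k(M,\mathbb{T}) \to \widehat{H}^k(M,\mathbb{T}) \xrightarrow{\mathrm{curv}} \Omega^{k+1}_{\mathbb{Z}}(M) \to 0$ is an exact sequence of abelian groups: the curvature map $\mathrm{curv}$ is a surjective group homomorphism onto the group of $(k+1)$-forms with integral periods, and its kernel is exactly the subgroup $H^k(M,\mathbb{T}) \cong \mathrm{Hom}(H_k(M),\mathbb{T})$ of differential characters that vanish on $k$-boundaries. -/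
/-!
Abstract framework for smooth singular chains, differential forms and
Cheeger--Simons differential characters on a (possibly infinite-dimensional)
manifold, following Bär--Becker and Cheeger--Simons.
-/

noncomputable section

/-- The circle group `𝕋 = ℝ/ℤ`. -/
abbrev TCirc : Type := AddCircle (1 : ℝ)

/-- The exponential map `exp_𝕋 : ℝ → 𝕋`, `t ↦ e^{2πit}` (written additively). -/
def expT : ℝ →+ TCirc := QuotientAddGroup.mk' (AddSubgroup.zmultiples (1 : ℝ))

/-- Abstract datum of a smooth manifold `M` (second countable finite dimensional,
or locally convex satisfying the de Rham theorem): the complex of smooth singular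
chains `C k`, the boundary operator `bd`, the differential forms `Ω k` with the
exterior differential `d`, and the integration pairing `intg` of forms against
chains, satisfying Stokes' theorem.  The axiom `nondeg` expresses that a form is
determined by the exponentials of its integrals over chains. -/
structure SmoothGeometry where
  /-- smooth singular `k`-chains -/
  C : ℕ → Type
  instC : ∀ k, AddCommGroup (C k)
  /-- the boundary operator `∂ : C_{k+1} → C_k` -/
  bd : ∀ k, C (k + 1) →+ C k
  bd_bd : ∀ (k : ℕ) (c : C (k + 2)), bd k (bd (k + 1) c) = 0
  /-- differential `k`-forms -/
  Ω : ℕ → Type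
  instΩ : ∀ k, AddCommGroup (Ω k)
  instΩmod : ∀ k, Module ℝ (Ω k)
  /-- exterior differential -/
  d : ∀ k, Ω k →ₗ[ℝ] Ω (k + 1)
  d_d : ∀ (k : ℕ) (α : Ω k), d (k + 1) (d k α) = 0
  /-- integration `∫_c ω` of a `k`-form over a `k`-chain -/
  intg : ∀ k, Ω k → (C k →+ ℝ)
  intg_zero : ∀ k, intg k 0 = 0
  intg_add : ∀ (k : ℕ) (α β : Ω k), intg k (α + β) = intg k α + intg k β
  intg_neg : ∀ (k : ℕ) (α : Ω k), intg k (-α) = -(intg k α)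
  /-- Stokes' theorem -/
  stokes : ∀ (k : ℕ) (α : Ω k) (c : C (k + 1)),
    intg (k + 1) (d k α) c = intg k α (bd k c)
  nondeg : ∀ (k : ℕ) (ω : Ω (k + 1)),
    (∀ σ : C (k + 1), expT (intg (k + 1) ω σ) = 0) → ω = 0

attribute [instance] SmoothGeometry.instC SmoothGeometry.instΩ SmoothGeometry.instΩmod

namespace SmoothGeometry

variable (G : SmoothGeometry)

/-- The group `Z_k(M)` of smooth singular `k`-cycles. -/
def Zc : ∀ k, AddSubgroup (G.C k)
  | 0 => ⊤
  | (k + 1) => (G.bd k).ker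

/-- The group `B_k(M)` of smooth singular `k`-boundaries. -/
def Bc (k : ℕ) : AddSubgroup (G.C k) := (G.bd k).range

theorem bd_mem_Zc (k : ℕ) (c : G.C (k + 1)) : G.bd k c ∈ G.Zc k := by
  cases k with
  | zero => simp [Zc]
  | succ n => simpa [Zc, AddMonoidHom.mem_ker] using G.bd_bd n c

theorem Bc_le_Zc (k : ℕ) : G.Bc k ≤ G.Zc k := by
  rintro x ⟨c, rfl⟩
  exact G.bd_mem_Zc k c

/-- `h : Z_k(M) → 𝕋` is a differential character with curvature `ω ∈ Ω^{k+1}(M)`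
if `h(∂σ) = exp_𝕋 (∫_σ ω)` for all smooth singular `(k+1)`-chains `σ`. -/
def IsDiffChar (k : ℕ) (h : ↥(G.Zc k) →+ TCirc) (ω : G.Ω (k + 1)) : Prop :=
  ∀ σ : G.C (k + 1), h ⟨G.bd k σ, G.bd_mem_Zc k σ⟩ = expT (G.intg (k + 1) ω σ)

/-- The group `Ĥ^k(M,𝕋)` of differential characters of degree `k`, as a subgroup
of `Hom(Z_k(M), 𝕋)`. -/
def DiffChar (k : ℕ) : AddSubgroup (↥(G.Zc k) →+ TCirc) where
  carrier := { h | ∃ ω : G.Ω (k + 1), G.IsDiffChar k h ω }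
  zero_mem' := ⟨0, fun σ => by simp [G.intg_zero]⟩
  add_mem' := by
    rintro h₁ h₂ ⟨ω₁, H₁⟩ ⟨ω₂, H₂⟩
    refine ⟨ω₁ + ω₂, fun σ => ?_⟩
    rw [AddMonoidHom.add_apply, H₁ σ, H₂ σ, G.intg_add, AddMonoidHom.add_apply, map_add]
  neg_mem' := by
    rintro h ⟨ω, H⟩
    refine ⟨-ω, fun σ => ?_⟩
    rw [AddMonoidHom.neg_apply, H σ, G.intg_neg, AddMonoidHom.neg_apply, map_neg]

theorem mem_diffChar_iff {k : ℕ} {h : ↥(G.Zc k) →+ TCirc} :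
    h ∈ G.DiffChar k ↔ ∃ ω : G.Ω (k + 1), G.IsDiffChar k h ω := Iff.rfl

/-- The curvature of a differential character. -/
def curv (k : ℕ) (h : ↥(G.DiffChar k)) : G.Ω (k + 1) :=
  ((G.mem_diffChar_iff.mp h.2).choose)

theorem curv_spec (k : ℕ) (h : ↥(G.DiffChar k)) : G.IsDiffChar k h.1 (G.curv k h) :=
  (G.mem_diffChar_iff.mp h.2).choose_spec

/-- A `k`-form has integral periods if all its integrals over `k`-cycles are integers. -/
def IntegralForm (k : ℕ) (ω : G.Ω k) : Prop :=
  ∀ c ∈ G.Zc k, ∃ n : ℤ, G.intg k ω c = (n : ℝ)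

end SmoothGeometry

/-- The de Rham theorem for `M`: a form all of whose periods vanish is exact, and
every real-valued homomorphism on cycles that vanishes on boundaries is realized
by integration against a closed form. -/
structure DeRhamHolds (G : SmoothGeometry) : Prop where
  exact_of_vanishing : ∀ (k : ℕ) (ω : G.Ω (k + 1)),
    (∀ c ∈ G.Zc (k + 1), G.intg (k + 1) ω c = 0) → ∃ α : G.Ω k, G.d k α = ω
  represent : ∀ (k : ℕ) (f : ↥(G.Zc k) →+ ℝ),
    (∀ σ : G.C (k + 1), f ⟨G.bd k σ, G.bd_mem_Zc k σ⟩ = 0) →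
    ∃ ω : G.Ω k, G.d k ω = 0 ∧ ∀ z : ↥(G.Zc k), G.intg k ω z.1 = f z

/-- For a manifold `M` on which the de Rham theorem holds, the
sequence `0 → H^k(M,𝕋) → Ĥ^k(M,𝕋) → Ω^{k+1}_ℤ(M) → 0` is an exact sequence of
abelian groups: the curvature map is an additive map which surjects onto the group
of `(k+1)`-forms with integral periods, and its kernel is exactly the subgroup
`H^k(M,𝕋) ≅ Hom(H_k(M),𝕋)` of differential characters vanishing on `k`-boundaries. -/
theorem statement0 (G : SmoothGeometry) (hDR : DeRhamHolds G)
    (hfree : ∀ n : ℕ, Module.Free ℤ ↥(G.Zc n)) (k : ℕ) :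
    (∀ h₁ h₂ : ↥(G.DiffChar k), G.curv k (h₁ + h₂) = G.curv k h₁ + G.curv k h₂) ∧
    (∀ h : ↥(G.DiffChar k), G.IntegralForm (k + 1) (G.curv k h)) ∧
    (∀ ω : G.Ω (k + 1), G.IntegralForm (k + 1) ω →
      ∃ h : ↥(G.DiffChar k), G.curv k h = ω) ∧
    (∀ h : ↥(G.DiffChar k), G.curv k h = 0 ↔
      ∀ (c : G.C k) (hc : c ∈ G.Bc k),
        (h : ↥(G.Zc k) →+ TCirc) ⟨c, G.Bc_le_Zc k hc⟩ = 0) := by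
  have hext : ∀ x : ℝ, expT x = 0 ↔ ∃ n : ℤ, x = (n : ℝ) := by
    intro x
    have : expT x = 0 ↔ x ∈ AddSubgroup.zmultiples (1 : ℝ) :=
      QuotientAddGroup.eq_zero_iff x
    rw [this, AddSubgroup.mem_zmultiples_iff]
    constructor
    · rintro ⟨n, hn⟩
      exact ⟨n, by rw [← hn]; simp⟩
    · rintro ⟨n, hn⟩
      exact ⟨n, by rw [hn]; simp⟩
  have huniq : ∀ (h : ↥(G.Zc k) →+ TCirc) (ω₁ ω₂ : G.Ω (k + 1)),
      G.IsDiffChar k h ω₁ → G.IsDiffChar k h ω₂ → ω₁ = ω₂ := by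
    intro h ω₁ ω₂ H₁ H₂
    have : ω₁ + -ω₂ = 0 := by
      apply G.nondeg k
      intro σ
      rw [G.intg_add, G.intg_neg, AddMonoidHom.add_apply, AddMonoidHom.neg_apply, map_add,
        map_neg, ← H₁ σ, ← H₂ σ, add_neg_cancel]
    exact add_neg_eq_zero.mp this
  refine ⟨?_, ?_, ?_, ?_⟩
  · intro h₁ h₂
    refine huniq (h₁ + h₂ : ↥(G.DiffChar k)).1 _ _ (G.curv_spec k _) ?_
    intro σ
    have e₁ := G.curv_spec k h₁ σ
    have e₂ := G.curv_spec k h₂ σ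
    rw [AddSubgroup.coe_add, AddMonoidHom.add_apply, e₁, e₂, G.intg_add,
      AddMonoidHom.add_apply, map_add]
  · intro h c hc
    rw [← hext, ← G.curv_spec k h c]
    have hc' : G.bd k c = 0 := hc
    have : (⟨G.bd k c, G.bd_mem_Zc k c⟩ : ↥(G.Zc k)) = 0 := Subtype.ext hc'
    rw [this, map_zero]
  · intro ω hω
    let bdZ : G.C (k + 1) →+ ↥(G.Zc k) := (G.bd k).codRestrict (G.Zc k) (G.bd_mem_Zc k)
    let φ : G.C (k + 1) →+ TCirc := expT.comp (G.intg (k + 1) ω)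
    have hker : bdZ.ker ≤ φ.ker := by
      intro c hc
      have hc' : G.bd k c = 0 := congrArg Subtype.val ((AddMonoidHom.mem_ker).1 hc)
      exact (hext _).2 (hω c hc')
    let ψ : (G.C (k + 1) ⧸ bdZ.ker) →+ TCirc := QuotientAddGroup.lift bdZ.ker φ hker
    obtain ⟨h, hh⟩ := (Module.Baer.of_divisible TCirc).extension_property_addMonoidHom
      (QuotientAddGroup.kerLift bdZ) (QuotientAddGroup.kerLift_injective bdZ) ψ
    have H : G.IsDiffChar k h ω := by
      intro σ
      exact DFunLike.congr_fun hh (QuotientAddGroup.mk σ : G.C (k + 1) ⧸ bdZ.ker)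
    exact ⟨⟨h, ω, H⟩, huniq h _ _ (G.curv_spec k ⟨h, ω, H⟩) H⟩
  · intro h
    constructor
    · rintro h0 c ⟨σ, rfl⟩
      have := G.curv_spec k h σ
      rw [h0, G.intg_zero, AddMonoidHom.zero_apply, map_zero] at this
      exact this
    · intro h0
      apply G.nondeg k
      intro σ
      rw [← G.curv_spec k h σ]
      exact h0 _ ⟨σ, rfl⟩
end
end

section
/- Let $h$ be a differential character of degree $k$ on $M$ and let $\tilde h\colon Z_k(M)\to\mathbb{R}$ be any group homomorphism lifting $h$ along $\mathbb{R}\to\mathbb{R}/\mathbb{Z}$ (such a lift exists because $Z_k(M)$ is a free abelian group). Then the map $\hat h\colon C_{k+1}(M)\to\mathbb{R}$, $\hat h(c)=\int_c \mathrm{curv}(h)-\tilde h(\partial c)$, takes values in $\mathbb{Z}$ and is a singular $(k+1)$-cocycle; its cohomology class $\mathrm{ch}(h)\in H^{k+1}(M,\mathbb{Z})$ is independent of the chosen lift $\tilde h$, and the image of $\mathrm{ch}(h)$ in $H^{k+1}(M,\mathbb{R})$ coincides, under the de Rham isomorphism, with the de Rham class of $\mathrm{curv}(h)$. -/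
/-!
Abstract framework for smooth singular chains, differential forms and
Cheeger--Simons differential characters on a (possibly infinite-dimensional)
manifold, following Bär--Becker and Cheeger--Simons.
-/

noncomputable section

/-- The cochain `ĥ(c) = ∫_c ω - h̃(∂c)` associated to a real lift `h̃` of a
differential character with curvature `ω`. -/
def chCochain (G : SmoothGeometry) (k : ℕ) (ω : G.Ω (k + 1))
    (t : ↥(G.Zc k) →+ ℝ) (c : G.C (k + 1)) : ℝ :=
  G.intg (k + 1) ω c - t ⟨G.bd k c, G.bd_mem_Zc k c⟩

/-- Let `h` be a differential character of degree `k` with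
curvature `ω`.  A real lift `h̃` of `h` exists since `Z_k(M)` is free abelian;
for any such lift the map `ĥ(c) = ∫_c ω - h̃(∂c)` is `ℤ`-valued and is an additive
singular `(k+1)`-cocycle; its cohomology class `ch(h) ∈ H^{k+1}(M,ℤ)` does not
depend on the chosen lift, and its image in real cohomology is (via the de Rham
isomorphism) the class of `ω = curv(h)`. -/
theorem statement1 (G : SmoothGeometry) (k : ℕ)
    (hfree : Module.Free ℤ ↥(G.Zc k))
    (hsplit : ∃ r : G.C k →+ ↥(G.Zc k), ∀ z : ↥(G.Zc k), r z.1 = z)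
    (h : ↥(G.Zc k) →+ TCirc) (ω : G.Ω (k + 1)) (hchar : G.IsDiffChar k h ω)
    (htilde htilde' : ↥(G.Zc k) →+ ℝ)
    (hlift : ∀ z : ↥(G.Zc k), expT (htilde z) = h z)
    (hlift' : ∀ z : ↥(G.Zc k), expT (htilde' z) = h z) :
    -- a lift exists because `Z_k(M)` is a free abelian group
    (∃ t : ↥(G.Zc k) →+ ℝ, ∀ z : ↥(G.Zc k), expT (t z) = h z) ∧
    -- `ĥ` takes values in `ℤ`
    (∀ c : G.C (k + 1), ∃ n : ℤ, chCochain G k ω htilde c = (n : ℝ)) ∧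
    -- `ĥ` is an additive cochain and a cocycle
    (∀ c₁ c₂ : G.C (k + 1),
      chCochain G k ω htilde (c₁ + c₂) = chCochain G k ω htilde c₁ + chCochain G k ω htilde c₂) ∧
    (∀ c : G.C (k + 2), chCochain G k ω htilde (G.bd (k + 1) c) = 0) ∧
    -- the class of `ĥ` in `H^{k+1}(M,ℤ)` is independent of the chosen lift
    (∃ g : G.C k →+ ℝ, (∀ c : G.C k, ∃ n : ℤ, g c = (n : ℝ)) ∧
      ∀ c : G.C (k + 1),
        chCochain G k ω htilde c - chCochain G k ω htilde' c = g (G.bd k c)) ∧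
    -- the image of `ch(h)` in `H^{k+1}(M,ℝ)` is the de Rham class of `curv h`:
    -- the real cocycles `c ↦ ∫_c ω` and `ĥ` differ by the coboundary of a real
    -- cochain extending `h̃`
    (∃ g : G.C k →+ ℝ, (∀ z : ↥(G.Zc k), g z.1 = htilde z) ∧
      ∀ c : G.C (k + 1),
        G.intg (k + 1) ω c - chCochain G k ω htilde c = g (G.bd k c)) := by
  have expT_int : ∀ x : ℝ, expT x = 0 → ∃ n : ℤ, x = (n : ℝ) := by
    intro x hx
    obtain ⟨n, hn⟩ := AddSubgroup.mem_zmultiples_iff.mp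
      ((QuotientAddGroup.eq_zero_iff x).mp hx)
    exact ⟨n, by rw [← hn]; simp⟩
  have bb : ∀ c : G.C (k + 2),
      (⟨G.bd k (G.bd (k + 1) c), G.bd_mem_Zc k _⟩ : ↥(G.Zc k)) = 0 :=
    fun c => Subtype.ext (G.bd_bd k c)
  have hadd : ∀ c₁ c₂ : G.C (k + 1),
      (⟨G.bd k (c₁ + c₂), G.bd_mem_Zc k _⟩ : ↥(G.Zc k)) =
        ⟨G.bd k c₁, G.bd_mem_Zc k _⟩ + ⟨G.bd k c₂, G.bd_mem_Zc k _⟩ :=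
    fun c₁ c₂ => Subtype.ext (map_add (G.bd k) c₁ c₂)
  -- the curvature is closed
  have hclosed : G.d (k + 1) ω = 0 := by
    apply G.nondeg (k + 1)
    intro σ
    rw [G.stokes, ← hchar, bb, map_zero]
  obtain ⟨r, hr⟩ := hsplit
  refine ⟨?_, ?_, ?_, ?_, ?_, ?_⟩
  · -- lift a basis of `Z_k(M)` and extend linearly
    let b := Module.Free.chooseBasis ℤ ↥(G.Zc k)
    have hs : Function.Surjective expT := QuotientAddGroup.mk'_surjective _
    choose s hs using hs
    let t : ↥(G.Zc k) →ₗ[ℤ] ℝ := b.constr ℤ (fun i => s (h (b i)))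
    have key : (expT.toIntLinearMap).comp t = h.toIntLinearMap := by
      apply b.ext
      intro i
      simp [t, Module.Basis.constr_basis, hs]
    exact ⟨t.toAddMonoidHom, fun z => LinearMap.congr_fun key z⟩
  · intro c
    apply expT_int
    rw [chCochain, map_sub, hlift, hchar, sub_self]
  · intro c₁ c₂
    simp only [chCochain]
    rw [hadd, map_add, map_add]
    ring
  · intro c
    simp only [chCochain]
    rw [bb, map_zero, ← G.stokes, hclosed, G.intg_zero]
    simp
  · refine ⟨(htilde' - htilde).comp r, ?_, ?_⟩
    · intro c
      apply expT_int
      simp [hlift, hlift']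
    · intro c
      have := hr ⟨G.bd k c, G.bd_mem_Zc k c⟩
      simp only at this
      simp [chCochain, this]
  · refine ⟨htilde.comp r, ?_, ?_⟩
    · intro z
      simp [hr]
    · intro c
      have := hr ⟨G.bd k c, G.bd_mem_Zc k c⟩
      simp only at this
      simp [chCochain, this]
end
end

section
/- For a manifold $M$ on which the de Rham theorem holds, the sequence $0\to \Omega^k_{\mathbb{Z}}(M)\to\Omega^k(M)\xrightarrow{i}\widehat{H}^k(M,\mathbb{T})\xrightarrow{\mathrm{ch}} H^{k+1}(M,\mathbb{Z})\to 0$ is exact, where $i(\alpha)(c)=\exp(2\pi i\int_c\alpha)$ for $c\in Z_k(M)$. In particular: $i(\alpha)$ is a differential character with $\mathrm{curv}(i(\alpha))=d\alpha$; the kernel of $i$ is exactly $\Omega^k_{\mathbb{Z}}(M)$; the image of $i$ is the kernel of $\mathrm{ch}$; and $\mathrm{ch}$ is surjective. -/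
/-!
Abstract framework for smooth singular chains, differential forms and
Cheeger--Simons differential characters on a (possibly infinite-dimensional)
manifold, following Bär--Becker and Cheeger--Simons.
-/

noncomputable section

/-- The differential character `i(α)(c) = exp_𝕋(∫_c α)` associated to a `k`-form `α`. -/
def iChar (G : SmoothGeometry) (k : ℕ) (α : G.Ω k) : ↥(G.Zc k) →+ TCirc :=
  expT.comp ((G.intg k α).comp (G.Zc k).subtype)

theorem curv_unique (G : SmoothGeometry) (k : ℕ) (h : ↥(G.DiffChar k)) (ω : G.Ω (k + 1))
    (H : G.IsDiffChar k h.1 ω) : G.curv k h = ω := by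
  have H' := G.curv_spec k h
  rw [← sub_eq_zero]
  apply G.nondeg k
  intro σ
  rw [sub_eq_add_neg, G.intg_add, G.intg_neg, AddMonoidHom.add_apply, AddMonoidHom.neg_apply,
    map_add, map_neg, ← H σ, ← H' σ, add_neg_cancel]

theorem expT_eq_zero_iff (x : ℝ) : expT x = 0 ↔ ∃ n : ℤ, x = (n : ℝ) := by
  have : expT x = (x : AddCircle (1 : ℝ)) := rfl
  rw [this, AddCircle.coe_eq_zero_iff]
  simp [eq_comm]

/-- Extension of homomorphisms into the divisible group of reals. -/
theorem extend_real {A B : Type} [AddCommGroup A] [AddCommGroup B] (p : A →+ B) (φ : A →+ ℝ)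
    (H : ∀ a, p a = 0 → φ a = 0) : ∃ t : B →+ ℝ, ∀ a, t (p a) = φ a := by
  have hle : p.ker ≤ φ.ker := fun a ha => H a ha
  obtain ⟨t, ht⟩ := (Module.Baer.of_divisible ℝ).extension_property_addMonoidHom
    (QuotientAddGroup.kerLift p) (QuotientAddGroup.kerLift_injective p)
    (QuotientAddGroup.lift p.ker φ hle)
  refine ⟨t, fun a => ?_⟩
  exact DFunLike.congr_fun ht (QuotientAddGroup.mk a)

/-- For a manifold `M` on which the de Rham theorem holds, the
sequence `0 → Ω^k_ℤ(M) → Ω^k(M) → Ĥ^k(M,𝕋) → H^{k+1}(M,ℤ) → 0` is exact: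
`i(α)` is a differential character with curvature `dα`; the kernel of `i` is
exactly the group of `k`-forms with integral periods; the image of `i` is the
kernel of `ch` (i.e. the characters whose associated integral cocycle is an
integral coboundary); and `ch` is surjective onto `H^{k+1}(M,ℤ)`. -/
theorem statement2 (G : SmoothGeometry) (hDR : DeRhamHolds G)
    (hfree : ∀ n : ℕ, Module.Free ℤ ↥(G.Zc n))
    (hsplit : ∀ n : ℕ, ∃ r : G.C n →+ ↥(G.Zc n), ∀ z : ↥(G.Zc n), r z.1 = z)
    (k : ℕ) :
    -- `i(α)` is a differential character with curvature `dα`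
    (∀ α : G.Ω k, G.IsDiffChar k (iChar G k α) (G.d k α)) ∧
    -- the kernel of `i` is exactly `Ω^k_ℤ(M)`
    (∀ α : G.Ω k, iChar G k α = 0 ↔ G.IntegralForm k α) ∧
    -- the image of `i` equals the kernel of `ch`
    (∀ h : ↥(G.DiffChar k),
      (∃ α : G.Ω k, iChar G k α = (h : ↥(G.Zc k) →+ TCirc)) ↔
      (∃ t : ↥(G.Zc k) →+ ℝ, (∀ z : ↥(G.Zc k), expT (t z) = (h : ↥(G.Zc k) →+ TCirc) z) ∧
        ∃ g : G.C k →+ ℝ, (∀ c : G.C k, ∃ n : ℤ, g c = (n : ℝ)) ∧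
          ∀ c : G.C (k + 1), chCochain G k (G.curv k h) t c = g (G.bd k c))) ∧
    -- `ch` is surjective
    (∀ f : G.C (k + 1) →+ ℝ, (∀ c : G.C (k + 1), ∃ n : ℤ, f c = (n : ℝ)) →
      (∀ c : G.C (k + 2), f (G.bd (k + 1) c) = 0) →
      ∃ h : ↥(G.DiffChar k), ∃ t : ↥(G.Zc k) →+ ℝ,
        (∀ z : ↥(G.Zc k), expT (t z) = (h : ↥(G.Zc k) →+ TCirc) z) ∧
        ∃ g : G.C k →+ ℝ, (∀ c : G.C k, ∃ n : ℤ, g c = (n : ℝ)) ∧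
          ∀ c : G.C (k + 1), chCochain G k (G.curv k h) t c = f c + g (G.bd k c)) := by
  have h1 : ∀ α : G.Ω k, G.IsDiffChar k (iChar G k α) (G.d k α) := by
    intro α σ
    rw [G.stokes]
    rfl
  refine ⟨h1, ?_, ?_, ?_⟩
  · intro α
    constructor
    · intro h c hc
      exact (expT_eq_zero_iff _).1 (DFunLike.congr_fun h ⟨c, hc⟩)
    · intro h
      ext z
      exact (expT_eq_zero_iff _).2 (h z.1 z.2)
  · intro h
    constructor
    · rintro ⟨α, hα⟩
      have hc : G.curv k h = G.d k α := curv_unique G k h _ (hα ▸ h1 α)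
      refine ⟨(G.intg k α).comp (G.Zc k).subtype, fun z => ?_, 0, fun c => ⟨0, by simp⟩,
        fun c => ?_⟩
      · rw [← hα]; rfl
      · rw [hc, chCochain, G.stokes]
        simp
    · rintro ⟨t, ht, g, hg, hch⟩
      have key : ∀ c : G.C (k + 1), G.intg (k + 1) (G.curv k h) c =
          t ⟨G.bd k c, G.bd_mem_Zc k c⟩ + g (G.bd k c) := by
        intro c
        have := hch c
        rw [chCochain] at this
        linarith
      obtain ⟨α, hα⟩ := hDR.exact_of_vanishing k (G.curv k h) (by
        intro c hc
        have hc' : G.bd k c = 0 := hc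
        rw [key c]
        have : (⟨G.bd k c, G.bd_mem_Zc k c⟩ : ↥(G.Zc k)) = 0 := Subtype.ext hc'
        rw [this, hc', map_zero, map_zero, add_zero])
      obtain ⟨β, -, hβ⟩ := hDR.represent k
        (t + g.comp (G.Zc k).subtype - (G.intg k α).comp (G.Zc k).subtype) (by
        intro σ
        have h2 := key σ
        rw [← hα, G.stokes] at h2
        simp only [AddMonoidHom.sub_apply, AddMonoidHom.add_apply, AddMonoidHom.comp_apply,
          AddSubgroup.subtype_apply]
        linarith)
      refine ⟨α + β, ?_⟩
      ext z
      change expT (G.intg k (α + β) z.1) = _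
      have h3 : G.intg k (α + β) z.1 = t z + g z.1 := by
        rw [G.intg_add, AddMonoidHom.add_apply, hβ z]
        simp
      rw [h3, map_add, ht, (expT_eq_zero_iff _).2 (hg z.1), add_zero]
  · intro f hf hcoc
    obtain ⟨ω, -, hω⟩ := hDR.represent (k + 1) (f.comp (G.Zc (k + 1)).subtype)
      (fun σ => hcoc σ)
    obtain ⟨t, ht⟩ := extend_real ((G.bd k).codRestrict (G.Zc k) (G.bd_mem_Zc k))
      (G.intg (k + 1) ω - f) (by
        intro a ha
        have ha' : G.bd k a = 0 := congrArg Subtype.val ha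
        have h4 := hω ⟨a, ha'⟩
        rw [AddMonoidHom.sub_apply, sub_eq_zero]
        exact h4)
    have ht' : ∀ c, t ⟨G.bd k c, G.bd_mem_Zc k c⟩ = G.intg (k + 1) ω c - f c := ht
    have hd : G.IsDiffChar k (expT.comp t) ω := by
      intro σ
      rw [AddMonoidHom.comp_apply, ht', map_sub, (expT_eq_zero_iff _).2 (hf σ), sub_zero]
    refine ⟨⟨expT.comp t, ω, hd⟩, t, fun z => rfl, 0, fun c => ⟨0, by simp⟩, fun c => ?_⟩
    rw [curv_unique G k _ ω hd, chCochain, ht']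
    simp
end
end

section
/- Let $\omega\in\Omega^{k+1}_{\mathbb{Z}}(M)$ and let $h\in\widehat{H}^k(M,\mathbb{T})$ satisfy $\mathrm{curv}(h)=\omega$. Then the map $\mathrm{Flux}_h\colon\mathrm{Diff}(M,\omega)\to H^k(M,\mathbb{T})$, $\mathrm{Flux}_h(\varphi)=(\varphi^{-1})^*h-h$, is well defined (its values have curvature zero) and is a $1$-cocycle for the pull-back action of $\mathrm{Diff}(M,\omega)$ on $H^k(M,\mathbb{T})$; its cohomology class in $H^1(\mathrm{Diff}(M,\omega),H^k(M,\mathbb{T}))$ is independent of the choice of $h$ with curvature $\omega$; and $\mathrm{Flux}_h(\varphi)=0$ if and only if $\varphi\in\mathrm{Diff}(M,h)$, so that $1\to\mathrm{Diff}(M,h)\to\mathrm{Diff}(M,\omega)\xrightarrow{\mathrm{Flux}_h}H^k(M,\mathbb{T})$ is exact. -/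
/-!
Abstract framework for smooth singular chains, differential forms and
Cheeger--Simons differential characters on a (possibly infinite-dimensional)
manifold, following Bär--Becker and Cheeger--Simons.
-/

noncomputable section

/-- An (abstract) action of the diffeomorphism group `Diff(M)` of `M`:
a group `D` acting on smooth singular chains (by push-forward `c ↦ φ ∘ c`)
and on differential forms (by pull-back), compatibly with the boundary
operator, the exterior differential and integration. -/
structure DiffeoAction (G : SmoothGeometry) where
  /-- the diffeomorphism group `Diff(M)` -/
  D : Type
  instD : Group D
  /-- push-forward of chains, `actC φ c = φ ∘ c` -/
  actC : D → ∀ k, G.C k →+ G.C k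
  actC_one : ∀ (k : ℕ) (c : G.C k), actC 1 k c = c
  actC_mul : ∀ (φ ψ : D) (k : ℕ) (c : G.C k), actC (φ * ψ) k c = actC φ k (actC ψ k c)
  actC_bd : ∀ (φ : D) (k : ℕ) (c : G.C (k + 1)),
    actC φ k (G.bd k c) = G.bd k (actC φ (k + 1) c)
  /-- pull-back of differential forms, `pull φ α = φ^* α` -/
  pull : D → ∀ k, G.Ω k →ₗ[ℝ] G.Ω k
  pull_one : ∀ (k : ℕ) (α : G.Ω k), pull 1 k α = α
  pull_mul : ∀ (φ ψ : D) (k : ℕ) (α : G.Ω k), pull (φ * ψ) k α = pull ψ k (pull φ k α)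
  pull_d : ∀ (φ : D) (k : ℕ) (α : G.Ω k), pull φ (k + 1) (G.d k α) = G.d k (pull φ k α)
  intg_pull : ∀ (φ : D) (k : ℕ) (α : G.Ω k) (c : G.C k),
    G.intg k (pull φ k α) c = G.intg k α (actC φ k c)

attribute [instance] DiffeoAction.instD

namespace DiffeoAction

variable {G : SmoothGeometry} (A : DiffeoAction G)

theorem actC_mem_Zc (φ : A.D) (k : ℕ) {c : G.C k} (hc : c ∈ G.Zc k) :
    A.actC φ k c ∈ G.Zc k := by
  cases k with
  | zero => simp [SmoothGeometry.Zc]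
  | succ n =>
    have hc' : G.bd n c = 0 := by
      simpa [SmoothGeometry.Zc, AddMonoidHom.mem_ker] using hc
    simp [SmoothGeometry.Zc, AddMonoidHom.mem_ker, ← A.actC_bd φ n c, hc']

/-- The action of a diffeomorphism on smooth singular cycles. -/
def actZ (φ : A.D) (k : ℕ) : ↥(G.Zc k) →+ ↥(G.Zc k) where
  toFun z := ⟨A.actC φ k z.1, A.actC_mem_Zc φ k z.2⟩
  map_zero' := Subtype.ext (by simp)
  map_add' z w := Subtype.ext (by simp)

/-- The pull-back `φ^* h` of a homomorphism `h : Z_k(M) → 𝕋` along a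
diffeomorphism, `(φ^* h)(c) = h(φ ∘ c)`. -/
def pullChar (φ : A.D) (k : ℕ) (h : ↥(G.Zc k) →+ TCirc) : ↥(G.Zc k) →+ TCirc :=
  h.comp (A.actZ φ k)

theorem isDiffChar_pullChar (φ : A.D) (k : ℕ) {h : ↥(G.Zc k) →+ TCirc} {ω : G.Ω (k + 1)}
    (H : G.IsDiffChar k h ω) :
    G.IsDiffChar k (A.pullChar φ k h) (A.pull φ (k + 1) ω) := by
  intro σ
  have e1 : (A.actZ φ k) ⟨G.bd k σ, G.bd_mem_Zc k σ⟩
      = ⟨G.bd k (A.actC φ (k + 1) σ), G.bd_mem_Zc k _⟩ :=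
    Subtype.ext (A.actC_bd φ k σ)
  calc (A.pullChar φ k h) ⟨G.bd k σ, G.bd_mem_Zc k σ⟩
      = h ((A.actZ φ k) ⟨G.bd k σ, G.bd_mem_Zc k σ⟩) := rfl
    _ = h ⟨G.bd k (A.actC φ (k + 1) σ), G.bd_mem_Zc k _⟩ := by rw [e1]
    _ = expT (G.intg (k + 1) ω (A.actC φ (k + 1) σ)) := H _
    _ = expT (G.intg (k + 1) (A.pull φ (k + 1) ω) σ) := by rw [A.intg_pull]

/-- The pull-back of a differential character along a diffeomorphism. -/
def pullCharD (φ : A.D) (k : ℕ) (h : ↥(G.DiffChar k)) : ↥(G.DiffChar k) :=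
  ⟨A.pullChar φ k h.1,
    ⟨A.pull φ (k + 1) (G.curv k h), A.isDiffChar_pullChar φ k (G.curv_spec k h)⟩⟩

end DiffeoAction

theorem pullChar_mul_aux {G : SmoothGeometry} (A : DiffeoAction G) (φ ψ : A.D) (k : ℕ)
    (h : ↥(G.Zc k) →+ TCirc) :
    A.pullChar (φ * ψ) k h = A.pullChar ψ k (A.pullChar φ k h) := by
  ext z
  exact congrArg h (Subtype.ext (A.actC_mul φ ψ k z.1))

theorem pullChar_one_aux {G : SmoothGeometry} (A : DiffeoAction G) (k : ℕ)
    (h : ↥(G.Zc k) →+ TCirc) : A.pullChar 1 k h = h := by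
  ext z
  exact congrArg h (Subtype.ext (A.actC_one k z.1))

theorem pullChar_sub_aux {G : SmoothGeometry} (A : DiffeoAction G) (φ : A.D) (k : ℕ)
    (h h' : ↥(G.Zc k) →+ TCirc) :
    A.pullChar φ k (h - h') = A.pullChar φ k h - A.pullChar φ k h' := by
  ext z
  rfl

theorem isDiffChar_sub_aux {G : SmoothGeometry} {k : ℕ} {h h' : ↥(G.Zc k) →+ TCirc}
    {ω : G.Ω (k + 1)} (H : G.IsDiffChar k h ω) (H' : G.IsDiffChar k h' ω) :
    G.IsDiffChar k (h - h') 0 := by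
  intro σ
  rw [AddMonoidHom.sub_apply, H σ, H' σ, G.intg_zero, sub_self, AddMonoidHom.zero_apply, map_zero]

/-- Let `ω ∈ Ω^{k+1}_ℤ(M)` and let `h ∈ Ĥ^k(M,𝕋)` have curvature
`ω`.  Then `Flux_h : Diff(M,ω) → H^k(M,𝕋)`, `Flux_h(φ) = (φ⁻¹)^* h - h`, is well
defined (its values are differential characters with curvature zero, i.e. lie in
`H^k(M,𝕋)`), it is a `1`-cocycle for the pull-back action of `Diff(M,ω)` on
`H^k(M,𝕋)`, its cohomology class is independent of the choice of `h` with
curvature `ω`, and `Flux_h(φ) = 0` iff `φ ∈ Diff(M,h)`, so that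
`1 → Diff(M,h) → Diff(M,ω) → H^k(M,𝕋)` is exact. -/
theorem statement4 (G : SmoothGeometry) (A : DiffeoAction G) (k : ℕ)
    (ω : G.Ω (k + 1)) (hint : G.IntegralForm (k + 1) ω)
    (h : ↥(G.Zc k) →+ TCirc) (hchar : G.IsDiffChar k h ω) :
    -- `Flux_h(φ)` has curvature zero, i.e. lies in `H^k(M,𝕋)`
    (∀ φ : A.D, A.pull φ (k + 1) ω = ω →
      G.IsDiffChar k (A.pullChar φ⁻¹ k h - h) 0) ∧
    -- `Flux_h` is a `1`-cocycle:  `Flux_h(φψ) = Flux_h(φ) + φ ⋅ Flux_h(ψ)`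
    (∀ φ ψ : A.D, A.pull φ (k + 1) ω = ω → A.pull ψ (k + 1) ω = ω →
      A.pullChar (φ * ψ)⁻¹ k h - h
        = (A.pullChar φ⁻¹ k h - h) + A.pullChar φ⁻¹ k (A.pullChar ψ⁻¹ k h - h)) ∧
    -- the class of `Flux_h` in `H¹(Diff(M,ω), H^k(M,𝕋))` does not depend on `h`:
    -- for any other character `h'` with curvature `ω` the difference of the two
    -- cocycles is the coboundary of some `a ∈ H^k(M,𝕋)`
    (∀ h' : ↥(G.Zc k) →+ TCirc, G.IsDiffChar k h' ω →
      ∃ a : ↥(G.Zc k) →+ TCirc, G.IsDiffChar k a 0 ∧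
        ∀ φ : A.D, A.pull φ (k + 1) ω = ω →
          (A.pullChar φ⁻¹ k h' - h') - (A.pullChar φ⁻¹ k h - h)
            = A.pullChar φ⁻¹ k a - a) ∧
    -- the kernel of `Flux_h` is exactly the stabilizer `Diff(M,h)`
    (∀ φ : A.D, A.pull φ (k + 1) ω = ω →
      (A.pullChar φ⁻¹ k h - h = 0 ↔ A.pullChar φ k h = h)) := by
  refine ⟨fun φ hφ => ?_, fun φ ψ _ _ => ?_, fun h' H' => ?_, fun φ _ => ?_⟩
  · have e : A.pull φ⁻¹ (k + 1) ω = ω := by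
      conv_lhs => rw [← hφ]
      rw [← A.pull_mul, mul_inv_cancel, A.pull_one]
    have H := A.isDiffChar_pullChar φ⁻¹ k hchar
    rw [e] at H
    exact isDiffChar_sub_aux H hchar
  · rw [mul_inv_rev, pullChar_mul_aux, pullChar_sub_aux]
    abel
  · refine ⟨h' - h, isDiffChar_sub_aux H' hchar, fun φ _ => ?_⟩
    rw [pullChar_sub_aux]
    abel
  · rw [sub_eq_zero]
    constructor
    · intro e
      conv_lhs => rw [← e]
      rw [← pullChar_mul_aux, inv_mul_cancel, pullChar_one_aux]
    · intro e
      conv_lhs => rw [← e]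
      rw [← pullChar_mul_aux, mul_inv_cancel, pullChar_one_aux]
end
end

section
/- Let $\omega$ be a closed $(k+1)$-form on a manifold $M$, and let $u,v,w$ be vector fields with $L_u\omega=L_v\omega=L_w\omega=0$ and with $i_u\omega=d\psi_u$ for some $(k-1)$-form $\psi_u$. Then $i_u i_{[v,w]}\omega+i_v i_{[w,u]}\omega+i_w i_{[u,v]}\omega=d\big((i_wL_v-i_vL_w+i_{[v,w]})\psi_u\big)$; in particular the cyclic sum $i_ui_{[v,w]}\omega+i_vi_{[w,u]}\omega+i_wi_{[u,v]}\omega$ is an exact $(k-1)$-form. -/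
/-!
Abstract framework for smooth singular chains, differential forms and
Cheeger--Simons differential characters on a (possibly infinite-dimensional)
manifold, following Bär--Becker and Cheeger--Simons.
-/

noncomputable section

/-- Abstract vector-field calculus on `M`: the Lie algebra `X = 𝔛(M)` of vector
fields, together with the interior product `i_v` and the Lie derivative `L_v`
acting on differential forms, satisfying the standard Cartan calculus identities. -/
structure VectorCalculus (G : SmoothGeometry) where
  /-- the Lie algebra `𝔛(M)` of vector fields -/
  X : Type
  instX : LieRing X
  instXalg : LieAlgebra ℝ X
  /-- interior product `i_v : Ω^{k+1} → Ω^k` -/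
  iprod : X → ∀ k, G.Ω (k + 1) →ₗ[ℝ] G.Ω k
  /-- Lie derivative `L_v : Ω^k → Ω^k` -/
  lie : X → ∀ k, G.Ω k →ₗ[ℝ] G.Ω k
  /-- Cartan's magic formula `L_v = d i_v + i_v d` -/
  cartan : ∀ (v : X) (k : ℕ) (α : G.Ω (k + 1)),
    lie v (k + 1) α = G.d k (iprod v k α) + iprod v (k + 1) (G.d (k + 1) α)
  /-- `i_{[v,w]} = L_v i_w - i_w L_v` -/
  iprod_bracket : ∀ (v w : X) (k : ℕ) (α : G.Ω (k + 1)),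
    iprod ⁅v, w⁆ k α = lie v k (iprod w k α) - iprod w k (lie v (k + 1) α)
  /-- `L_v d = d L_v` -/
  lie_d : ∀ (v : X) (k : ℕ) (α : G.Ω k),
    lie v (k + 1) (G.d k α) = G.d k (lie v k α)
  /-- `L_{[v,w]} = L_v L_w - L_w L_v` -/
  lie_bracket : ∀ (v w : X) (k : ℕ) (α : G.Ω k),
    lie ⁅v, w⁆ k α = lie v k (lie w k α) - lie w k (lie v k α)
  /-- `i_v i_w = - i_w i_v` -/
  iprod_anticomm : ∀ (v w : X) (k : ℕ) (α : G.Ω (k + 2)),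
    iprod v k (iprod w (k + 1) α) = - iprod w k (iprod v (k + 1) α)
  iprod_addV : ∀ (v w : X) (k : ℕ) (α : G.Ω (k + 1)),
    iprod (v + w) k α = iprod v k α + iprod w k α
  iprod_smulV : ∀ (r : ℝ) (v : X) (k : ℕ) (α : G.Ω (k + 1)),
    iprod (r • v) k α = r • iprod v k α
  lie_addV : ∀ (v w : X) (k : ℕ) (α : G.Ω k),
    lie (v + w) k α = lie v k α + lie w k α
  lie_smulV : ∀ (r : ℝ) (v : X) (k : ℕ) (α : G.Ω k),
    lie (r • v) k α = r • lie v k α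

attribute [instance] VectorCalculus.instX VectorCalculus.instXalg

/-- Let `ω` be a closed `(k+3)`-form, and let `u, v, w` be
vector fields with `L_u ω = L_v ω = L_w ω = 0` and `i_u ω = dψ_u`.  Then
`i_u i_{[v,w]} ω + i_v i_{[w,u]} ω + i_w i_{[u,v]} ω
  = d((i_w L_v - i_v L_w + i_{[v,w]}) ψ_u)`;
in particular this cyclic sum is an exact form. -/
theorem statement14 (G : SmoothGeometry) (V : VectorCalculus G) (k : ℕ)
    (ω : G.Ω (k + 3)) (hω : G.d (k + 3) ω = 0)
    (u v w : V.X)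
    (hu : V.lie u (k + 3) ω = 0) (hv : V.lie v (k + 3) ω = 0)
    (hw : V.lie w (k + 3) ω = 0)
    (ψu : G.Ω (k + 1)) (hψu : V.iprod u (k + 2) ω = G.d (k + 1) ψu) :
    V.iprod u (k + 1) (V.iprod ⁅v, w⁆ (k + 2) ω)
      + V.iprod v (k + 1) (V.iprod ⁅w, u⁆ (k + 2) ω)
      + V.iprod w (k + 1) (V.iprod ⁅u, v⁆ (k + 2) ω)
      = G.d k (V.iprod w k (V.lie v (k + 1) ψu)
          - V.iprod v k (V.lie w (k + 1) ψu)
          + V.iprod ⁅v, w⁆ k ψu) ∧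
    ∃ θ : G.Ω k,
      V.iprod u (k + 1) (V.iprod ⁅v, w⁆ (k + 2) ω)
        + V.iprod v (k + 1) (V.iprod ⁅w, u⁆ (k + 2) ω)
        + V.iprod w (k + 1) (V.iprod ⁅u, v⁆ (k + 2) ω) = G.d k θ := by
  have key : V.iprod u (k + 1) (V.iprod ⁅v, w⁆ (k + 2) ω)
      + V.iprod v (k + 1) (V.iprod ⁅w, u⁆ (k + 2) ω)
      + V.iprod w (k + 1) (V.iprod ⁅u, v⁆ (k + 2) ω)
      = G.d k (V.iprod w k (V.lie v (k + 1) ψu)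
          - V.iprod v k (V.lie w (k + 1) ψu)
          + V.iprod ⁅v, w⁆ k ψu) := by
    -- first term
    have h1 : V.iprod u (k + 1) (V.iprod ⁅v, w⁆ (k + 2) ω)
        = G.d k (V.iprod ⁅v, w⁆ k ψu)
          - (V.lie v (k + 1) (V.lie w (k + 1) ψu) - V.lie w (k + 1) (V.lie v (k + 1) ψu)) := by
      rw [← V.lie_bracket, V.cartan ⁅v, w⁆ k ψu, V.iprod_anticomm u ⁅v, w⁆ (k + 1) ω, hψu]
      abel
    -- `i_{[x,u]} ω = d L_x ψ_u` whenever `L_x ω = 0`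
    have hb : ∀ x : V.X, V.lie x (k + 3) ω = 0 →
        V.iprod ⁅x, u⁆ (k + 2) ω = G.d (k + 1) (V.lie x (k + 1) ψu) := by
      intro x hx
      rw [V.iprod_bracket x u (k + 2) ω, hx, map_zero, sub_zero, hψu, V.lie_d]
    have hn : V.iprod ⁅u, v⁆ (k + 2) ω = -V.iprod ⁅v, u⁆ (k + 2) ω := by
      have h := V.iprod_smulV (-1) ⁅v, u⁆ (k + 2) ω
      rw [neg_one_smul, neg_one_smul, lie_skew] at h
      exact h
    have h2 := V.cartan v k (V.lie w (k + 1) ψu)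
    have h3 := V.cartan w k (V.lie v (k + 1) ψu)
    rw [h1, hn, hb w hw, hb v hv, map_neg, h2, h3, map_add, map_sub]
    abel
  exact ⟨key, _, key⟩
end
end
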